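/- arXiv:1410.7803 — 2 statements merged into one kernel-verified Lean document; each statement's English description precedes it below -/
import Mathlib

section
/- Let k be a field, let U, V, Q be finite-dimensional k-vector spaces, let q : U → Q be a surjective k-linear map with kernel U' and inclusion ι : U' → U, and let L be a subspace of U ⊗ V. Let L^⊥ be the annihilator of L inside (U ⊗ V)*, regarded via the canonical isomorphism (U ⊗ V)* ≅ U* ⊗ V* as a subspace of U* ⊗ V*. Define M_L : L → V ⊗ Q as the composition of the inclusion L ⊆ U ⊗ V with the map U ⊗ V ≅ V ⊗ U → V ⊗ Q induced by q, and define M^L : L^⊥ → V* ⊗ U'* as the composition of the inclusion L^⊥ ⊆ U* ⊗ V* with the map U* ⊗ V* ≅ V* ⊗ U* → V* ⊗ U'* induced by the dual map ι* : U* → U'*. Then there are k-linear isomorphisms ker(M^L) ≅ ((V ⊗ Q) / range M_L)* and (V* ⊗ U'*) / range(M^L) ≅ (ker M_L)*. -/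
open TensorProduct

section AnnihilatorDuality

variable {k W B E D : Type*} [Field k] [AddCommGroup W] [Module k W] [AddCommGroup B] [Module k B]
  [AddCommGroup E] [Module k E] [AddCommGroup D] [Module k D]

/-- If `p : W → B` is surjective and `j : E ≅ W* → D` has kernel the annihilator of `ker p`, then
the kernel of `j` on the annihilator of `L` is dual to the cokernel of `p` on `L`. -/
theorem nonempty_ker_domRestrict_dualAnnihilator_equiv
    (p : W →ₗ[k] B) (hp : Function.Surjective p) (e : E ≃ₗ[k] Module.Dual k W) (j : E →ₗ[k] D)
    (hj : LinearMap.ker j = (LinearMap.ker p).dualAnnihilator.comap e.toLinearMap)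
    (L : Submodule k W) :
    Nonempty (LinearMap.ker (j ∘ₗ (L.dualAnnihilator.comap e.toLinearMap).subtype) ≃ₗ[k]
      Module.Dual k (B ⧸ LinearMap.range (p ∘ₗ L.subtype))) := by
  have hinj : Function.Injective (e.symm.toLinearMap ∘ₗ p.dualMap) :=
    e.symm.injective.comp (LinearMap.dualMap_injective_of_surjective hp)
  have key : (LinearMap.ker (j ∘ₗ (L.dualAnnihilator.comap e.toLinearMap).subtype)).map
      (L.dualAnnihilator.comap e.toLinearMap).subtype =
      (LinearMap.range (p ∘ₗ L.subtype)).dualAnnihilator.map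
        (e.symm.toLinearMap ∘ₗ p.dualMap) := by
    rw [LinearMap.ker_comp, Submodule.map_comap_subtype, hj,
      ← LinearMap.range_dualMap_eq_dualAnnihilator_ker p]
    ext x
    simp only [Submodule.mem_inf, Submodule.mem_comap, Submodule.mem_map, LinearMap.mem_range,
      Submodule.mem_dualAnnihilator, LinearEquiv.coe_coe, LinearMap.comp_apply]
    constructor
    · rintro ⟨hx, φ, hφ⟩
      refine ⟨φ, ?_, by rw [hφ, e.symm_apply_apply]⟩
      rintro _ ⟨l, rfl⟩
      have := hx l l.2
      rwa [← hφ] at this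
    · rintro ⟨φ, hφ, rfl⟩
      refine ⟨fun w hw => ?_, φ, by rw [e.apply_symm_apply]⟩
      rw [e.apply_symm_apply]
      exact hφ _ ⟨⟨w, hw⟩, rfl⟩
  exact ⟨Submodule.equivMapOfInjective _ (Submodule.injective_subtype _) _ ≪≫ₗ
    LinearEquiv.ofEq _ _ key ≪≫ₗ (Submodule.equivMapOfInjective _ hinj _).symm ≪≫ₗ
    (Submodule.dualQuotEquivDualAnnihilator _).symm⟩

/-- If `j : E ≅ W* → D` is surjective with kernel the annihilator of `ker p`, then the cokernel of
`j` on the annihilator of `L` is dual to the kernel of `p` on `L`. -/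
theorem exists_surjective_ker_eq_range_domRestrict_dualAnnihilator
    (p : W →ₗ[k] B) (e : E ≃ₗ[k] Module.Dual k W) (j : E →ₗ[k] D) (hjs : Function.Surjective j)
    (hj : LinearMap.ker j = (LinearMap.ker p).dualAnnihilator.comap e.toLinearMap)
    (L : Submodule k W) :
    ∃ π : D →ₗ[k] Module.Dual k (LinearMap.ker (p ∘ₗ L.subtype)), Function.Surjective π ∧
      LinearMap.ker π =
        LinearMap.range (j ∘ₗ (L.dualAnnihilator.comap e.toLinearMap).subtype) := by
  set i : LinearMap.ker (p ∘ₗ L.subtype) →ₗ[k] W :=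
    L.subtype ∘ₗ (LinearMap.ker (p ∘ₗ L.subtype)).subtype with hi
  have hi_inj : Function.Injective i :=
    (Submodule.injective_subtype _).comp (Submodule.injective_subtype _)
  have hi_range : LinearMap.range i = L ⊓ LinearMap.ker p := by
    rw [hi, LinearMap.range_comp, Submodule.range_subtype, LinearMap.ker_comp,
      Submodule.map_comap_subtype]
  set f : E →ₗ[k] Module.Dual k (LinearMap.ker (p ∘ₗ L.subtype)) :=
    i.dualMap ∘ₗ e.toLinearMap with hf
  have hf_surj : Function.Surjective f :=
    (LinearMap.dualMap_surjective_of_injective hi_inj).comp e.surjective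
  have hf_ker : LinearMap.ker f =
      L.dualAnnihilator.comap e.toLinearMap ⊔ LinearMap.ker j := by
    rw [hf, LinearMap.ker_comp, LinearMap.ker_dualMap_eq_dualAnnihilator_range, hi_range,
      Subspace.dualAnnihilator_inf_eq, hj]
    simp only [Submodule.comap_equiv_eq_map_symm, Submodule.map_sup]
  obtain ⟨s, hs⟩ := j.exists_rightInverse_of_surjective (LinearMap.range_eq_top.2 hjs)
  have hsj (d : D) : j (s d) = d := LinearMap.congr_fun hs d
  have hfs (x : E) : f (s (j x)) = f x := by
    have hx : s (j x) - x ∈ LinearMap.ker f := by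
      rw [hf_ker]
      exact Submodule.mem_sup_right (by simp [hsj])
    rwa [LinearMap.mem_ker, map_sub, sub_eq_zero] at hx
  refine ⟨f ∘ₗ s, fun y => ?_, ?_⟩
  · obtain ⟨x, rfl⟩ := hf_surj y
    exact ⟨j x, hfs x⟩
  · ext d
    rw [LinearMap.ker_comp, hf_ker, LinearMap.range_comp, Submodule.range_subtype,
      Submodule.mem_comap, Submodule.mem_sup, Submodule.mem_map]
    constructor
    · rintro ⟨y, hy, z, hz, hyz⟩
      refine ⟨y, hy, ?_⟩
      rw [← hsj d, ← hyz, map_add, LinearMap.mem_ker.1 hz, add_zero]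
    · rintro ⟨y, hy, rfl⟩
      exact ⟨y, hy, s (j y) - y, by simp [hsj], by abel⟩

end AnnihilatorDuality

/-- Under `U* ⊗ V* ≅ (U ⊗ V)*`, the kernel of `U* ⊗ V* → V* ⊗ (ker q)*` is the annihilator of the
kernel of `U ⊗ V → V ⊗ Q`. -/
theorem TensorProduct.ker_map_dualMap_subtype_comp_comm {k U V Q : Type*} [Field k]
    [AddCommGroup U] [Module k U] [FiniteDimensional k U]
    [AddCommGroup V] [Module k V] [FiniteDimensional k V]
    [AddCommGroup Q] [Module k Q] (q : U →ₗ[k] Q) (hq : Function.Surjective q) :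
    LinearMap.ker (TensorProduct.map (LinearMap.id : Module.Dual k V →ₗ[k] Module.Dual k V)
        (LinearMap.ker q).subtype.dualMap ∘ₗ
        (TensorProduct.comm k (Module.Dual k U) (Module.Dual k V)).toLinearMap) =
      (LinearMap.ker (TensorProduct.map (LinearMap.id : V →ₗ[k] V) q ∘ₗ
        (TensorProduct.comm k U V).toLinearMap)).dualAnnihilator.comap
        (TensorProduct.dualDistribEquiv k U V).toLinearMap := by
  set i : V ⊗[k] LinearMap.ker q →ₗ[k] U ⊗[k] V :=
    (TensorProduct.comm k V U).toLinearMap ∘ₗ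
      TensorProduct.map LinearMap.id (LinearMap.ker q).subtype with hi
  have hi_range : LinearMap.range i = LinearMap.ker
      (TensorProduct.map (LinearMap.id : V →ₗ[k] V) q ∘ₗ
        (TensorProduct.comm k U V).toLinearMap) := by
    have hexact : LinearMap.ker (TensorProduct.map (LinearMap.id : V →ₗ[k] V) q) =
        LinearMap.range (TensorProduct.map LinearMap.id (LinearMap.ker q).subtype) :=
      (lTensor_exact V (LinearMap.exact_subtype_ker_map q) hq).linearMap_ker_eq
    rw [hi, LinearMap.range_comp, LinearMap.ker_comp, hexact, Submodule.comap_equiv_eq_map_symm,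
      TensorProduct.comm_symm]
  have hcomm : (TensorProduct.dualDistribEquiv k V (LinearMap.ker q)).toLinearMap ∘ₗ
      (TensorProduct.map (LinearMap.id : Module.Dual k V →ₗ[k] Module.Dual k V)
        (LinearMap.ker q).subtype.dualMap ∘ₗ
        (TensorProduct.comm k (Module.Dual k U) (Module.Dual k V)).toLinearMap) =
      i.dualMap ∘ₗ (TensorProduct.dualDistribEquiv k U V).toLinearMap := by
    ext a b v u
    simp [hi, TensorProduct.dualDistribEquiv, TensorProduct.dualDistribEquivOfBasis, mul_comm]
  rw [← hi_range, ← LinearMap.ker_dualMap_eq_dualAnnihilator_range, ← LinearMap.ker_comp, ← hcomm,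
    LinearEquiv.ker_comp]

/-- Duality between kernels and cokernels of the maps `M_L : L → V ⊗ Q` and
`M^L : L^⊥ → V* ⊗ U'*` attached to a surjection `q : U → Q` with kernel `U' = ker q`
and a subspace `L ⊆ U ⊗ V`: there are `k`-linear isomorphisms
`ker M^L ≅ ((V ⊗ Q) / range M_L)*` and `(V* ⊗ U'*) / range M^L ≅ (ker M_L)*`.
The second isomorphism is expressed by a surjective linear map
`π : V* ⊗ U'* → (ker M_L)*` whose kernel is exactly `range M^L`, which by the first
isomorphism theorem says precisely that the cokernel of `M^L` is isomorphic to
`(ker M_L)*`. -/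
theorem kernel_cokernel_duality {k : Type*} [Field k]
    {U V Q : Type*}
    [AddCommGroup U] [Module k U] [FiniteDimensional k U]
    [AddCommGroup V] [Module k V] [FiniteDimensional k V]
    [AddCommGroup Q] [Module k Q] [FiniteDimensional k Q]
    (q : U →ₗ[k] Q) (hq : Function.Surjective q)
    (L : Submodule k (U ⊗[k] V))
    -- `L^⊥`: the annihilator of `L`, seen inside `U* ⊗ V*` via `(U ⊗ V)* ≅ U* ⊗ V*`
    (Lperp : Submodule k (Module.Dual k U ⊗[k] Module.Dual k V))
    (hLperp : Lperp = (Submodule.dualAnnihilator L).comap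
      (TensorProduct.dualDistribEquiv k U V).toLinearMap)
    -- `M_L : L → V ⊗ Q`, the restriction to `L` of `U ⊗ V ≅ V ⊗ U → V ⊗ Q`
    (ML : L →ₗ[k] V ⊗[k] Q)
    (hML : ML = (TensorProduct.map (LinearMap.id : V →ₗ[k] V) q) ∘ₗ
      (TensorProduct.comm k U V).toLinearMap ∘ₗ L.subtype)
    -- `M^L : L^⊥ → V* ⊗ U'*`, the restriction to `L^⊥` of `U* ⊗ V* ≅ V* ⊗ U* → V* ⊗ U'*`
    (MLperp : Lperp →ₗ[k] Module.Dual k V ⊗[k] Module.Dual k (LinearMap.ker q))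
    (hMLperp : MLperp =
      (TensorProduct.map (LinearMap.id : Module.Dual k V →ₗ[k] Module.Dual k V)
        ((LinearMap.ker q).subtype.dualMap)) ∘ₗ
      (TensorProduct.comm k (Module.Dual k U) (Module.Dual k V)).toLinearMap ∘ₗ
      Lperp.subtype) :
    -- `ker M^L ≅ (coker M_L)*`
    Nonempty ((LinearMap.ker MLperp) ≃ₗ[k]
        Module.Dual k ((V ⊗[k] Q) ⧸ LinearMap.range ML)) ∧
    -- `coker M^L ≅ (ker M_L)*`
    (∃ π : (Module.Dual k V ⊗[k] Module.Dual k (LinearMap.ker q)) →ₗ[k]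
        Module.Dual k (LinearMap.ker ML),
      Function.Surjective π ∧ LinearMap.ker π = LinearMap.range MLperp) := by
  rw [← LinearMap.comp_assoc] at hML hMLperp
  subst hLperp hML hMLperp
  have hps : Function.Surjective (TensorProduct.map (LinearMap.id : V →ₗ[k] V) q ∘ₗ
      (TensorProduct.comm k U V).toLinearMap) :=
    (TensorProduct.map_surjective Function.surjective_id hq).comp (LinearEquiv.surjective _)
  have hjs : Function.Surjective
      (TensorProduct.map (LinearMap.id : Module.Dual k V →ₗ[k] Module.Dual k V)
        (LinearMap.ker q).subtype.dualMap ∘ₗ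
        (TensorProduct.comm k (Module.Dual k U) (Module.Dual k V)).toLinearMap) :=
    (TensorProduct.map_surjective Function.surjective_id
      (LinearMap.dualMap_surjective_of_injective (Submodule.injective_subtype _))).comp
      (LinearEquiv.surjective _)
  have hj := TensorProduct.ker_map_dualMap_subtype_comp_comm (V := V) q hq
  -- The modules are named because unification does not find their group structures by itself.
  exact ⟨nonempty_ker_domRestrict_dualAnnihilator_equiv (W := U ⊗[k] V) (B := V ⊗[k] Q)
      (E := Module.Dual k U ⊗[k] Module.Dual k V)
      (D := Module.Dual k V ⊗[k] Module.Dual k (LinearMap.ker q)) _ hps _ _ hj L,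
    exists_surjective_ker_eq_range_domRestrict_dualAnnihilator (W := U ⊗[k] V) (B := V ⊗[k] Q)
      (E := Module.Dual k U ⊗[k] Module.Dual k V)
      (D := Module.Dual k V ⊗[k] Module.Dual k (LinearMap.ker q)) _ _ _ hjs hj L⟩
end

section
/- Let k be a field, let U, V, Q be finite-dimensional k-vector spaces with dim U = m, dim V = n, dim Q = r, let q : U → Q be a surjective k-linear map with kernel U' and inclusion ι : U' → U, and let L be a subspace of U ⊗ V with dim L = n·r. Let L^⊥ be the annihilator of L inside (U ⊗ V)*, regarded via the canonical isomorphism (U ⊗ V)* ≅ U* ⊗ V* as a subspace of U* ⊗ V*. Define M_L : L → V ⊗ Q as the composition of the inclusion L ⊆ U ⊗ V with the map U ⊗ V ≅ V ⊗ U → V ⊗ Q induced by q, and define M^L : L^⊥ → V* ⊗ U'* as the composition of the inclusion L^⊥ ⊆ U* ⊗ V* with the map U* ⊗ V* ≅ V* ⊗ U* → V* ⊗ U'* induced by the dual map ι* : U* → U'*. Then M_L is bijective if and only if M^L is bijective. (Hence, for c = nr, the determinantal hypersurfaces D_L = V(det M_L) and D^L = V(det M^L) in the Grassmannian G(U, r)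 coincide.) -/
open TensorProduct

/-- The restriction of a surjective linear map to a subspace is bijective exactly when the subspace
is a complement of the kernel. -/
theorem LinearMap.bijective_domRestrict_iff {k W A : Type*} [Field k]
    [AddCommGroup W] [Module k W] [AddCommGroup A] [Module k A]
    {f : W →ₗ[k] A} (hf : Function.Surjective f) (L : Submodule k W) :
    Function.Bijective (f.domRestrict L) ↔ IsCompl L (LinearMap.ker f) := by
  rw [Function.Bijective, LinearMap.injective_domRestrict_iff,
    LinearMap.surjective_domRestrict_iff hf, isCompl_iff]

theorem Subspace.isCompl_dualAnnihilator_iff {k W : Type*} [Field k]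
    [AddCommGroup W] [Module k W] {L K : Subspace k W} :
    IsCompl (Submodule.dualAnnihilator L) (Submodule.dualAnnihilator K) ↔ IsCompl L K := by
  refine ⟨fun h => ?_, Subspace.isCompl_dualAnnihilator⟩
  rw [isCompl_iff, disjoint_iff, codisjoint_iff, ← Subspace.dualAnnihilator_inj,
    ← Subspace.dualAnnihilator_inj (W := L ⊔ K), Subspace.dualAnnihilator_inf_eq,
    Submodule.dualAnnihilator_sup_eq, Submodule.dualAnnihilator_bot,
    Submodule.dualAnnihilator_top]
  exact ⟨h.sup_eq_top, h.inf_eq_bot⟩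

/-- Under `U* ⊗ V* ≅ (U ⊗ V)*`, the kernel of `U* ⊗ V* → V* ⊗ U'*` is the annihilator of the
image of `V ⊗ U' → U ⊗ V`. -/
theorem TensorProduct.ker_map_dualMap_comp_comm {k U U' V : Type*} [Field k]
    [AddCommGroup U] [Module k U] [FiniteDimensional k U]
    [AddCommGroup U'] [Module k U'] [FiniteDimensional k U']
    [AddCommGroup V] [Module k V] [FiniteDimensional k V] (i : U' →ₗ[k] U) :
    LinearMap.ker (TensorProduct.map (LinearMap.id : Module.Dual k V →ₗ[k] Module.Dual k V)
        i.dualMap ∘ₗ (TensorProduct.comm k (Module.Dual k U) (Module.Dual k V)).toLinearMap) =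
      (LinearMap.range ((TensorProduct.comm k V U).toLinearMap ∘ₗ
        i.lTensor V)).dualAnnihilator.comap
          (TensorProduct.dualDistribEquiv k U V).toLinearMap := by
  have naturality : (TensorProduct.dualDistribEquiv k V U').toLinearMap ∘ₗ
      TensorProduct.map LinearMap.id i.dualMap ∘ₗ
        (TensorProduct.comm k (Module.Dual k U) (Module.Dual k V)).toLinearMap =
      ((TensorProduct.comm k V U).toLinearMap ∘ₗ i.lTensor V).dualMap ∘ₗ
        (TensorProduct.dualDistribEquiv k U V).toLinearMap := by
    ext f g v u
    exact mul_comm (g v) (f (i u))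
  rw [← LinearMap.ker_dualMap_eq_dualAnnihilator_range, ← LinearMap.ker_comp, ← naturality,
    LinearEquiv.ker_comp]

/-- Right exactness of `V ⊗ -`, with the tensor factors of the middle term swapped. -/
theorem TensorProduct.ker_map_comp_comm {k U V Q : Type*} [Field k]
    [AddCommGroup U] [Module k U] [AddCommGroup V] [Module k V] [AddCommGroup Q] [Module k Q]
    {q : U →ₗ[k] Q} (hq : Function.Surjective q) :
    LinearMap.ker (TensorProduct.map (LinearMap.id : V →ₗ[k] V) q ∘ₗ
        (TensorProduct.comm k U V).toLinearMap) =
      LinearMap.range ((TensorProduct.comm k V U).toLinearMap ∘ₗ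
        (LinearMap.ker q).subtype.lTensor V) := by
  have hex := LinearMap.exact_iff.mp
    (lTensor_exact V (LinearMap.exact_subtype_ker_map q) hq)
  rw [LinearMap.ker_comp, LinearMap.range_comp, ← hex]
  exact (Submodule.map_equiv_eq_comap_symm (TensorProduct.comm k V U) _).symm

/-- For `c = nr`, the map `M_L : L → V ⊗ Q` is invertible if and only if the dual map
`M^L : L^⊥ → V* ⊗ U'*` is invertible.  Hence the degeneracy hypersurfaces
`D_L = V(det M_L)` and `D^L = V(det M^L)` in the Grassmannian `G(U, r)` coincide. -/
theorem ML_bijective_iff_MLperp_bijective {k : Type*} [Field k]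
    {U V Q : Type*}
    [AddCommGroup U] [Module k U] [FiniteDimensional k U]
    [AddCommGroup V] [Module k V] [FiniteDimensional k V]
    [AddCommGroup Q] [Module k Q] [FiniteDimensional k Q]
    (m n r : ℕ)
    (hU : Module.finrank k U = m) (hV : Module.finrank k V = n)
    (hQ : Module.finrank k Q = r)
    (q : U →ₗ[k] Q) (hq : Function.Surjective q)
    (L : Submodule k (U ⊗[k] V)) (hL : Module.finrank k L = n * r)
    -- `L^⊥`: the annihilator of `L`, seen inside `U* ⊗ V*` via `(U ⊗ V)* ≅ U* ⊗ V*`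
    (Lperp : Submodule k (Module.Dual k U ⊗[k] Module.Dual k V))
    (hLperp : Lperp = (Submodule.dualAnnihilator L).comap
      (TensorProduct.dualDistribEquiv k U V).toLinearMap)
    -- `M_L : L → V ⊗ Q`, the restriction to `L` of `U ⊗ V ≅ V ⊗ U → V ⊗ Q`
    (ML : L →ₗ[k] V ⊗[k] Q)
    (hML : ML = (TensorProduct.map (LinearMap.id : V →ₗ[k] V) q) ∘ₗ
      (TensorProduct.comm k U V).toLinearMap ∘ₗ L.subtype)
    -- `M^L : L^⊥ → V* ⊗ U'*`, the restriction to `L^⊥` of `U* ⊗ V* ≅ V* ⊗ U* → V* ⊗ U'*`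
    (MLperp : Lperp →ₗ[k] Module.Dual k V ⊗[k] Module.Dual k (LinearMap.ker q))
    (hMLperp : MLperp =
      (TensorProduct.map (LinearMap.id : Module.Dual k V →ₗ[k] Module.Dual k V)
        ((LinearMap.ker q).subtype.dualMap)) ∘ₗ
      (TensorProduct.comm k (Module.Dual k U) (Module.Dual k V)).toLinearMap ∘ₗ
      Lperp.subtype) :
    Function.Bijective ML ↔ Function.Bijective MLperp := by
  subst hLperp hML hMLperp
  have hf : Function.Surjective (TensorProduct.map (LinearMap.id : V →ₗ[k] V) q ∘ₗ
      (TensorProduct.comm k U V).toLinearMap) :=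
    (TensorProduct.map_surjective Function.surjective_id hq).comp
      (TensorProduct.comm k U V).surjective
  have hg : Function.Surjective (TensorProduct.map
      (LinearMap.id : Module.Dual k V →ₗ[k] Module.Dual k V) (LinearMap.ker q).subtype.dualMap ∘ₗ
        (TensorProduct.comm k (Module.Dual k U) (Module.Dual k V)).toLinearMap) :=
    (TensorProduct.map_surjective Function.surjective_id
      (LinearMap.dualMap_surjective_of_injective (LinearMap.ker q).injective_subtype)).comp
      (TensorProduct.comm k (Module.Dual k U) (Module.Dual k V)).surjective
  have hperp := LinearMap.bijective_domRestrict_iff (k := k)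
    (W := Module.Dual k U ⊗[k] Module.Dual k V)
    (A := Module.Dual k V ⊗[k] Module.Dual k (LinearMap.ker q)) hg
    (L.dualAnnihilator.comap (TensorProduct.dualDistribEquiv k U V).toLinearMap)
  refine (LinearMap.bijective_domRestrict_iff hf L).trans (Iff.trans ?_ hperp.symm)
  rw [TensorProduct.ker_map_dualMap_comp_comm, TensorProduct.ker_map_comp_comm hq,
    ← Subspace.isCompl_dualAnnihilator_iff]
  exact (Submodule.orderIsoMapComap
    (TensorProduct.dualDistribEquiv k U V)).symm.isCompl_iff
end
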